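/- Let T be a regular s-interval exchange transformation on [ℓ,r). For any semi-interval I = [u,v) that is admissible for T, the transformation S induced by T on I is a regular s-interval exchange transformation whose set of separation points is Sep(S) = Div(I,T) ∩ I. -/

import Mathlib

open Set MeasureTheory

noncomputable section

/-- Left endpoint `γ i` of the `i`-th exchanged semi-interval. -/
def sepPt {s : ℕ} (l : ℝ) (len : Fin s → ℝ) (i : Fin s) : ℝ :=
  l + ∑ j ∈ Finset.univ.filter (fun j => j < i), len j

/-- Left endpoint `δ` of the image of the `i`-th exchanged semi-interval. -/
def imgPt {s : ℕ} (l : ℝ) (len : Fin s → ℝ) (π : Equiv.Perm (Fin s)) (i : Fin s) : ℝ :=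
  l + ∑ j ∈ Finset.univ.filter (fun j => π j < π i), len j

/-- `T` is the `s`-interval exchange transformation on `[l,r)` with lengths `len`
and permutation `π`, extended by the identity outside `[l,r)`. -/
def IsIET (s : ℕ) (l r : ℝ) (len : Fin s → ℝ) (π : Equiv.Perm (Fin s))
    (T : Equiv.Perm ℝ) : Prop :=
  l < r ∧ (∀ i, 0 < len i) ∧ (∑ i, len i) = r - l ∧
  (∀ z, z ∉ Set.Ico l r → T z = z) ∧
  ∀ i : Fin s, ∀ z ∈ Set.Ico (sepPt l len i) (sepPt l len i + len i),
    T z = z + (imgPt l len π i - sepPt l len i)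

/-- The two-sided orbit `{T^n z : n ∈ ℤ}`. -/
def orbitZ (T : Equiv.Perm ℝ) (z : ℝ) : Set ℝ := {w | ∃ n : ℤ, (T ^ n) z = w}

/-- Regularity (idoc): the orbits of the nonzero separation points are infinite
and pairwise disjoint. -/
def IsRegularIET (s : ℕ) (l : ℝ) (len : Fin s → ℝ) (T : Equiv.Perm ℝ) : Prop :=
  (∀ i : Fin s, (i : ℕ) ≠ 0 → (orbitZ T (sepPt l len i)).Infinite) ∧
  (∀ i j : Fin s, (i : ℕ) ≠ 0 → (j : ℕ) ≠ 0 → i ≠ j →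
    Disjoint (orbitZ T (sepPt l len i)) (orbitZ T (sepPt l len j)))

/-- Minimality: every (two-sided) orbit of a point of `[l,r)` is dense in `[l,r)`. -/
def IsMinimalOn (T : Equiv.Perm ℝ) (l r : ℝ) : Prop :=
  ∀ z ∈ Set.Ico l r, Set.Ico l r ⊆ closure (orbitZ T z)

/-- First return time of `z` in `I` (defined via `sInf`; meaningful when `T` is minimal). -/
def returnTime (T : Equiv.Perm ℝ) (I : Set ℝ) (z : ℝ) : ℕ :=
  sInf {n : ℕ | 0 < n ∧ (T ^ n) z ∈ I}

/-- The transformation induced by `T` on `I` (first-return map). -/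
def inducedMap (T : Equiv.Perm ℝ) (I : Set ℝ) (z : ℝ) : ℝ :=
  (T ^ returnTime T I z) z

/-- The transformation induced by `T` on `[u,v)` is an interval exchange
transformation on `k` intervals with data `(lam, σ)`. -/
def InducedData (T : Equiv.Perm ℝ) (u v : ℝ) (k : ℕ) (lam : Fin k → ℝ)
    (σ : Equiv.Perm (Fin k)) : Prop :=
  ∃ S : Equiv.Perm ℝ, IsIET k u v lam σ S ∧
    ∀ z ∈ Set.Ico u v, S z = inducedMap T (Set.Ico u v) z

/-- The semi-interval `[l,t)` is right admissible for `T`. -/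
def RightAdmissible (s : ℕ) (l r : ℝ) (len : Fin s → ℝ) (T : Equiv.Perm ℝ)
    (t : ℝ) : Prop :=
  l < t ∧ t < r ∧ ∃ (i : Fin s) (k : ℤ), t = (T ^ k) (sepPt l len i) ∧
    (0 < k → ∀ h : ℤ, 0 < h → h < k → t < (T ^ h) (sepPt l len i)) ∧
    (k ≤ 0 → ∀ h : ℤ, k < h → h ≤ 0 → t < (T ^ h) (sepPt l len i))

/-- `ρ⁺_{I,T}(z) = min {n > 0 : T^n z ∈ (u,v)}`. -/
def rhoPlusPt (T : Equiv.Perm ℝ) (u v z : ℝ) : ℕ :=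
  sInf {n : ℕ | 0 < n ∧ (T ^ n) z ∈ Set.Ioo u v}

/-- `ρ⁻_{I,T}(z) = min {n ≥ 0 : T^{-n} z ∈ (u,v)}`. -/
def rhoMinusPt (T : Equiv.Perm ℝ) (u v z : ℝ) : ℕ :=
  sInf {n : ℕ | (T⁻¹ ^ n) z ∈ Set.Ioo u v}

/-- The set of neighbours `N_{I,T}(z)` of `z` with respect to `I = [u,v)` and `T`. -/
def neighbours (T : Equiv.Perm ℝ) (u v z : ℝ) : Set ℝ :=
  {w | ∃ k : ℤ, -(rhoMinusPt T u v z : ℤ) ≤ k ∧ k < (rhoPlusPt T u v z : ℤ) ∧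
    w = (T ^ k) z}

/-- The set of division points `Div(I,T)` of `I = [u,v)` with respect to `T`. -/
def divPoints (s : ℕ) (l : ℝ) (len : Fin s → ℝ) (T : Equiv.Perm ℝ)
    (u v : ℝ) : Set ℝ :=
  ⋃ i : Fin s, neighbours T u v (sepPt l len i)

/-- The semi-interval `[u,v) ⊆ [l,r)` is admissible for `T`. -/
def Admissible (s : ℕ) (l r : ℝ) (len : Fin s → ℝ) (T : Equiv.Perm ℝ)
    (u v : ℝ) : Prop :=
  l ≤ u ∧ u < v ∧ v ≤ r ∧
  u ∈ divPoints s l len T u v ∪ {r} ∧ v ∈ divPoints s l len T u v ∪ {r}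

/-- A bundled regular `s`-interval exchange transformation. -/
structure RIET (s : ℕ) where
  l : ℝ
  r : ℝ
  len : Fin s → ℝ
  perm : Equiv.Perm (Fin s)
  T : Equiv.Perm ℝ
  isIET : IsIET s l r len perm T
  isReg : IsRegularIET s l len T

/-- The right endpoint `max (γ_s, δ_{π(s)})` of `Z(T)`. -/
def zPoint {s : ℕ} (X : RIET s) : ℝ :=
  if h : 0 < s then
    max (sepPt X.l X.len ⟨s - 1, by omega⟩)
      (imgPt X.l X.len X.perm (X.perm.symm ⟨s - 1, by omega⟩))
  else X.r

/-- The left endpoint `min (γ_2, δ_{π(2)})` of `Y(T)`. -/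
def yPoint {s : ℕ} (X : RIET s) : ℝ :=
  if h : 1 < s then
    min (sepPt X.l X.len ⟨1, h⟩) (imgPt X.l X.len X.perm (X.perm.symm ⟨1, h⟩))
  else X.l

/-- `Y = ψ(X)`: one step of the right Rauzy induction. -/
def PsiStep {s : ℕ} (X Y : RIET s) : Prop :=
  Y.l = X.l ∧ Y.r = zPoint X ∧
  ∀ z ∈ Set.Ico X.l (zPoint X), Y.T z = inducedMap X.T (Set.Ico X.l (zPoint X)) z

/-- `Y = φ(X)`: one step of the left Rauzy induction. -/
def PhiStep {s : ℕ} (X Y : RIET s) : Prop :=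
  Y.l = yPoint X ∧ Y.r = X.r ∧
  ∀ z ∈ Set.Ico (yPoint X) X.r, Y.T z = inducedMap X.T (Set.Ico (yPoint X) X.r) z

/-- Equivalence of two `s`-interval exchange transformations: `(σ, mu)` is obtained
from `(π, lam)` by rescaling, possibly combined with the reversal `τ : i ↦ s - i + 1`. -/
def IETEquiv (s : ℕ) (π σ : Equiv.Perm (Fin s)) (lam mu : Fin s → ℝ) : Prop :=
  (∃ c : ℝ, 0 < c ∧ σ = π ∧ ∀ i, mu i = c * lam i) ∨
  (∃ c : ℝ, 0 < c ∧ (∀ i, σ i = (π i).rev) ∧ ∀ i, mu i = c * lam i.rev)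

/-- The subring `ℤ[√d]` of `ℝ`. -/
def Zsd (d : ℤ) : Set ℝ := {z | ∃ m n : ℤ, z = (m : ℝ) + (n : ℝ) * Real.sqrt d}

/-- `Ψ(z) = max (|m|,|n|)` for `z = m + n√d` (the representation being unique
when `d ≥ 2` is squarefree). -/
def PsiNum (d : ℤ) (z : ℝ) : ℕ :=
  sInf {k : ℕ | ∃ m n : ℤ, z = (m : ℝ) + (n : ℝ) * Real.sqrt d ∧
    k = max m.natAbs n.natAbs}

/-- `Ψ(S) = max {Ψ(z) : z ∈ ∂S}`. -/
def PsiSet (d : ℤ) (S : Set ℝ) : ℕ := sSup (PsiNum d '' frontier S)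

/-- The reduced complexity `Π(S) = |S| ⬝ Ψ(S)`. -/
def PiSet (d : ℤ) (S : Set ℝ) : ℝ := (volume S).toReal * PsiSet d S

/-- `S` belongs to the algebra `A([l,r))`: a nonempty finite union of semi-intervals
of `[l,r)` with endpoints in `ℤ[√d]`. -/
def MemA (d : ℤ) (l r : ℝ) (S : Set ℝ) : Prop :=
  S.Nonempty ∧ S ⊆ Set.Ico l r ∧
  ∃ (k : ℕ) (a b : Fin k → ℝ), (∀ j, a j ∈ Zsd d ∧ b j ∈ Zsd d ∧ a j < b j) ∧
    S = ⋃ j, Set.Ico (a j) (b j)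

/-- The interval exchange transformation with data `(l, r, len, π)` is defined over
`ℤ[√d]`: `l`, `r`, the separation points and the translation values lie in `ℤ[√d]`. -/
def DefinedOverZ (d : ℤ) (s : ℕ) (l r : ℝ) (len : Fin s → ℝ)
    (π : Equiv.Perm (Fin s)) : Prop :=
  l ∈ Zsd d ∧ r ∈ Zsd d ∧
  ∀ i, sepPt l len i ∈ Zsd d ∧ (imgPt l len π i - sepPt l len i) ∈ Zsd d

/-- Maximal positive return time `ρ⁺(S)`. -/
def rhoPlusSet (T : Equiv.Perm ℝ) (S : Set ℝ) : ℕ :=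
  sInf {n : ℕ | 1 ≤ n ∧ ⇑(T ^ n) '' S ⊆ ⋃ i ∈ Finset.range n, ⇑(T ^ i) '' S}

/-- Maximal negative return time `ρ⁻(S)`. -/
def rhoMinusSet (T : Equiv.Perm ℝ) (S : Set ℝ) : ℕ :=
  sInf {m : ℕ | 1 ≤ m ∧ ⇑(T ^ m) '' S ⊆ ⋃ i ∈ Finset.range m, ⇑(T⁻¹ ^ i) '' S}

/-- Minimal positive return time `σ⁺(S)`. -/
def sigmaPlusSet (T : Equiv.Perm ℝ) (S : Set ℝ) : ℕ :=
  sInf {n : ℕ | 1 ≤ n ∧ (⇑(T ^ n) '' S ∩ S).Nonempty}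

/-- Minimal negative return time `σ⁻(S)`. -/
def sigmaMinusSet (T : Equiv.Perm ℝ) (S : Set ℝ) : ℕ :=
  sInf {m : ℕ | 1 ≤ m ∧ (⇑(T⁻¹ ^ m) '' S ∩ S).Nonempty}

/-- `D_{m,n}(T) = ⋃_{i=-m+1}^{n} T^i (Sep(T))`. -/
def Dmn (s : ℕ) (l : ℝ) (len : Fin s → ℝ) (T : Equiv.Perm ℝ) (m n : ℕ) : Set ℝ :=
  {w | ∃ (i : Fin s) (k : ℤ), -(m : ℤ) + 1 ≤ k ∧ k ≤ (n : ℤ) ∧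
    w = (T ^ k) (sepPt l len i)}

/-- `[u,v)` belongs to `U(T) = ⋃_{m,n ≥ 1} U_{m,n}(T)`: it is one of the
semi-intervals into which `D_{m,n}(T)` partitions `[l,r)`. -/
def MemU (s : ℕ) (l r : ℝ) (len : Fin s → ℝ) (T : Equiv.Perm ℝ) (u v : ℝ) : Prop :=
  ∃ m n : ℕ, 1 ≤ m ∧ 1 ≤ n ∧ u ∈ Dmn s l len T m n ∧
    (v ∈ Dmn s l len T m n ∨ v = r) ∧ ∀ w ∈ Dmn s l len T m n, w ∉ Set.Ioo u v

section Cells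

variable {s : ℕ} {l : ℝ} {len : Fin s → ℝ}

lemma sepPt_of_val_eq_zero {i : Fin s} (hi : (i : ℕ) = 0) : sepPt l len i = l := by
  have : Finset.univ.filter (fun j : Fin s => j < i) = ∅ := by
    ext j
    simp [Fin.lt_def, hi]
  simp [sepPt, this]

lemma sepPt_add (i : Fin s) :
    sepPt l len i + len i = l + ∑ j ∈ Finset.univ.filter (fun j => j ≤ i), len j := by
  have : Finset.univ.filter (fun j : Fin s => j ≤ i)
      = insert i (Finset.univ.filter (fun j => j < i)) := by
    ext j
    simp [le_iff_eq_or_lt]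
  rw [sepPt, this, Finset.sum_insert (by simp)]
  ring

lemma sepPt_eq_add {i j : Fin s} (h : (j : ℕ) = i + 1) :
    sepPt l len j = sepPt l len i + len i := by
  rw [sepPt_add, sepPt]
  congr 2
  ext k
  simp only [Finset.mem_filter, Finset.mem_univ, true_and, Fin.lt_def, Fin.le_def]
  omega

lemma sepPt_add_of_last {i : Fin s} (h : (i : ℕ) + 1 = s) :
    sepPt l len i + len i = l + ∑ j, len j := by
  rw [sepPt_add, Finset.filter_true_of_mem]
  intro k _
  rw [Fin.le_def]
  omega

lemma sepPt_add_le (hpos : ∀ i, 0 < len i) {i j : Fin s} (h : i < j) :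
    sepPt l len i + len i ≤ sepPt l len j := by
  rw [sepPt_add, sepPt]
  refine add_le_add le_rfl (Finset.sum_le_sum_of_subset_of_nonneg (fun k hk => ?_)
    fun k _ _ => (hpos k).le)
  simp only [Finset.mem_filter, Finset.mem_univ, true_and] at hk ⊢
  exact lt_of_le_of_lt hk h

lemma sepPt_strictMono (hpos : ∀ i, 0 < len i) : StrictMono (sepPt l len) := by
  intro i j h
  have := sepPt_add_le (l := l) hpos h
  linarith [hpos i]

lemma le_sepPt (hpos : ∀ i, 0 < len i) (i : Fin s) : l ≤ sepPt l len i := by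
  have : 0 ≤ ∑ j ∈ Finset.univ.filter (fun j => j < i), len j :=
    Finset.sum_nonneg fun k _ => (hpos k).le
  rw [sepPt]
  linarith

lemma lt_sepPt (hpos : ∀ i, 0 < len i) {i : Fin s} (hi : (i : ℕ) ≠ 0) :
    l < sepPt l len i := by
  have h := sepPt_strictMono (l := l) hpos
    (show (⟨0, by omega⟩ : Fin s) < i from Fin.lt_def.2 (by simp; omega))
  rwa [sepPt_of_val_eq_zero rfl] at h

lemma sepPt_add_le_total (hpos : ∀ i, 0 < len i) (i : Fin s) :
    sepPt l len i + len i ≤ l + ∑ j, len j := by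
  rw [sepPt_add]
  exact add_le_add le_rfl (Finset.sum_le_sum_of_subset_of_nonneg (Finset.filter_subset _ _)
    fun k _ _ => (hpos k).le)

lemma sepPt_notMem_Ioo (hpos : ∀ i, 0 < len i) (i j : Fin s) :
    sepPt l len j ∉ Ioo (sepPt l len i) (sepPt l len i + len i) := by
  rintro ⟨h1, h2⟩
  have := (sepPt_strictMono (l := l) hpos).lt_iff_lt.1 h1
  linarith [sepPt_add_le (l := l) hpos this]

lemma exists_mem_cell {z : ℝ} (hz : z ∈ Ico l (l + ∑ j, len j)) :
    ∃ i, z ∈ Ico (sepPt l len i) (sepPt l len i + len i) := by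
  have hs : 0 < s := by
    rcases Nat.eq_zero_or_pos s with h | h
    · subst h
      simp at hz
    · exact h
  have hne : (Finset.univ.filter fun i : Fin s => sepPt l len i ≤ z).Nonempty :=
    ⟨⟨0, hs⟩, by simpa [sepPt_of_val_eq_zero (l := l) (len := len) (i := ⟨0, hs⟩) rfl] using hz.1⟩
  obtain ⟨i, hi, hmax⟩ := Finset.exists_max_image _ (fun i : Fin s => i) hne
  refine ⟨i, (Finset.mem_filter.1 hi).2, ?_⟩
  by_contra! hlt
  by_cases hlast : (i : ℕ) + 1 = s
  · rw [sepPt_add_of_last hlast] at hlt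
    exact absurd hz.2 (not_lt.2 hlt)
  · have hi' : (i : ℕ) + 1 < s := by omega
    have := hmax ⟨i + 1, hi'⟩ (by
      simp only [Finset.mem_filter, Finset.mem_univ, true_and]
      rwa [sepPt_eq_add (i := i) rfl])
    simp [Fin.le_def] at this

/-- A finite subset of `(u, v)`, together with `u`, is the set of separation points of a
subdivision of `[u, v)`. -/
lemma exists_lengths {u v : ℝ} (huv : u < v) (F : Finset ℝ) (hF : ∀ x ∈ F, x ∈ Ioo u v)
    {k : ℕ} (hk : F.card + 1 = k) :
    ∃ lam : Fin k → ℝ, (∀ i, 0 < lam i) ∧ ∑ i, lam i = v - u ∧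
      range (sepPt u lam) = insert u (F : Set ℝ) := by
  classical
  have huF : u ∉ F := fun h => lt_irrefl _ (hF u h).1
  have hcard : (insert u F).card = k := by rw [Finset.card_insert_of_notMem huF, hk]
  set e := (insert u F).orderEmbOfFin hcard with he
  have hrange : range e = insert u (F : Set ℝ) := by
    rw [he, Finset.range_orderEmbOfFin, Finset.coe_insert]
  have hmem : ∀ i, u ≤ e i ∧ e i < v := by
    intro i
    have : e i ∈ insert u (F : Set ℝ) := hrange ▸ mem_range_self i
    rcases this with h | h
    · rw [h]; exact ⟨le_rfl, huv⟩
    · exact ⟨(hF _ h).1.le, (hF _ h).2⟩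
  have hk0 : 0 < k := by omega
  have he0 : e ⟨0, hk0⟩ = u := by
    obtain ⟨i, hi⟩ : u ∈ range e := hrange ▸ mem_insert _ _
    refine le_antisymm ?_ (hmem _).1
    rw [← hi]
    exact e.monotone (Fin.le_def.2 (Nat.zero_le _))
  let lam : Fin k → ℝ := fun i => (if h : (i : ℕ) + 1 < k then e ⟨i + 1, h⟩ else v) - e i
  have hsep : ∀ n (hn : n < k), sepPt u lam ⟨n, hn⟩ = e ⟨n, hn⟩ := by
    intro n
    induction n with
    | zero => intro hn; rw [sepPt_of_val_eq_zero rfl, he0]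
    | succ n ih =>
      intro hn
      rw [sepPt_eq_add (i := ⟨n, by omega⟩) rfl, ih]
      simp [lam, hn]
  have hsep' : sepPt u lam = e := funext fun i => hsep i i.2
  refine ⟨lam, fun i => ?_, ?_, by rw [hsep', hrange]⟩
  · by_cases h : (i : ℕ) + 1 < k
    · have : e i < e ⟨i + 1, h⟩ := e.strictMono (Fin.lt_def.2 (by simp))
      simp only [lam, h, dite_true]
      linarith
    · simp only [lam, h, dite_false]
      linarith [(hmem i).2]
  · have h := sepPt_add_of_last (l := u) (len := lam) (i := ⟨k - 1, by omega⟩) (by simp; omega)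
    rw [hsep'] at h
    have h2 : lam ⟨k - 1, by omega⟩ = v - e ⟨k - 1, by omega⟩ := by
      simp only [lam]
      rw [dif_neg (by omega)]
    linarith

lemma sum_le_of_disjoint_Ico {ι : Type*} (t : Finset ι) (e lam : ι → ℝ) {a b : ℝ} (hab : a ≤ b)
    (hpos : ∀ i ∈ t, 0 ≤ lam i)
    (hsub : ∀ i ∈ t, Ico (e i) (e i + lam i) ⊆ Ico a b)
    (hdisj : (t : Set ι).PairwiseDisjoint fun i => Ico (e i) (e i + lam i)) :
    ∑ i ∈ t, lam i ≤ b - a := by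
  have h1 : volume (⋃ i ∈ t, Ico (e i) (e i + lam i)) ≤ volume (Ico a b) :=
    measure_mono (iUnion₂_subset hsub)
  rw [measure_biUnion_finset hdisj fun _ _ => measurableSet_Ico] at h1
  simp only [Real.volume_Ico, add_sub_cancel_left] at h1
  rw [← ENNReal.ofReal_sum_of_nonneg hpos] at h1
  exact (ENNReal.ofReal_le_ofReal_iff (by linarith)).1 h1

end Cells

section Exchange

variable {s : ℕ} {l r : ℝ} {len : Fin s → ℝ} {π : Equiv.Perm (Fin s)} {T : Equiv.Perm ℝ}

lemma sepPt_comp_symm (k : Fin s) :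
    sepPt l (len ∘ π.symm) k = imgPt l len π (π.symm k) := by
  simp only [sepPt, imgPt, Finset.sum_filter]
  congr 1
  rw [← Equiv.sum_comp π]
  simp

lemma imgPt_comp_symm (k : Fin s) :
    imgPt l (len ∘ π.symm) π⁻¹ k = sepPt l len (π.symm k) := by
  simp only [sepPt, imgPt, Finset.sum_filter]
  congr 1
  rw [← Equiv.sum_comp π]
  simp [Equiv.Perm.inv_def]

lemma IsIET.total (h : IsIET s l r len π T) : l + ∑ j, len j = r := by
  linarith [h.2.2.1]

lemma IsIET.exists_cell (h : IsIET s l r len π T) {z : ℝ} (hz : z ∈ Ico l r) :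
    ∃ i, z ∈ Ico (sepPt l len i) (sepPt l len i + len i) :=
  exists_mem_cell (by rwa [h.total])

lemma IsIET.cell_subset (h : IsIET s l r len π T) (i : Fin s) :
    Ico (sepPt l len i) (sepPt l len i + len i) ⊆ Ico l r := by
  rw [← h.total]
  exact Ico_subset_Ico (le_sepPt h.2.1 i) (sepPt_add_le_total h.2.1 i)

lemma IsIET.sepPt_mem (h : IsIET s l r len π T) (i : Fin s) : sepPt l len i ∈ Ico l r :=
  h.cell_subset i ⟨le_rfl, by linarith [h.2.1 i]⟩

lemma IsIET.apply_mem (h : IsIET s l r len π T) {z : ℝ} (hz : z ∈ Ico l r) : T z ∈ Ico l r := by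
  by_contra hc
  have := T.injective (h.2.2.2.1 _ hc)
  rw [this] at hc
  exact hc hz

lemma IsIET.pow_apply_mem (h : IsIET s l r len π T) {z : ℝ} (hz : z ∈ Ico l r) (n : ℕ) :
    (T ^ n) z ∈ Ico l r := by
  induction n with
  | zero => simpa using hz
  | succ n ih => rw [pow_succ', Equiv.Perm.mul_apply]; exact h.apply_mem ih

lemma IsIET.apply_sepPt (h : IsIET s l r len π T) (i : Fin s) :
    T (sepPt l len i) = imgPt l len π i := by
  rw [h.2.2.2.2 i _ ⟨le_rfl, by linarith [h.2.1 i]⟩]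
  ring

lemma IsIET.inv (h : IsIET s l r len π T) : IsIET s l r (len ∘ π.symm) π⁻¹ T⁻¹ := by
  refine ⟨h.1, fun i => h.2.1 _, ?_, fun z hz => ?_, fun k z hz => ?_⟩
  · rw [← h.2.2.1]
    exact Equiv.sum_comp π.symm len
  · rw [Equiv.Perm.inv_eq_iff_eq, h.2.2.2.1 z hz]
  · rw [sepPt_comp_symm] at hz ⊢
    rw [imgPt_comp_symm, Equiv.Perm.inv_eq_iff_eq,
      h.2.2.2.2 (π.symm k) _ (by
        simp only [Function.comp_apply, mem_Ico] at hz ⊢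
        constructor <;> linarith [hz.1, hz.2])]
    ring

lemma IsIET.sepPt_inv (h : IsIET s l r len π T) (k : Fin s) :
    sepPt l (len ∘ π.symm) k = T (sepPt l len (π.symm k)) := by
  rw [sepPt_comp_symm, h.apply_sepPt]

lemma IsIET.continuousAt (h : IsIET s l r len π T) {w : ℝ} (hw : w ≠ r)
    (hsep : ∀ i, w ≠ sepPt l len i) : ContinuousAt T w := by
  by_cases hin : w ∈ Ico l r
  · obtain ⟨i, hi⟩ := h.exists_cell hin
    have hnhds : Ioo (sepPt l len i) (sepPt l len i + len i) ∈ nhds w :=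
      Ioo_mem_nhds (lt_of_le_of_ne hi.1 (hsep i).symm) hi.2
    have heq : (fun z => z + (imgPt l len π i - sepPt l len i)) =ᶠ[nhds w] T := by
      filter_upwards [hnhds] with z hz
      exact (h.2.2.2.2 i z ⟨hz.1.le, hz.2⟩).symm
    exact ContinuousAt.congr (by fun_prop) heq
  · have hnhds : (Icc l r)ᶜ ∈ nhds w := by
      refine isClosed_Icc.isOpen_compl.mem_nhds fun hw' => hin ⟨hw'.1, lt_of_le_of_ne hw'.2 hw⟩
    have heq : (fun z => z) =ᶠ[nhds w] T := by
      filter_upwards [hnhds] with z hz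
      exact (h.2.2.2.1 z fun hz' => hz (Ico_subset_Icc_self hz')).symm
    exact ContinuousAt.congr continuousAt_id heq

lemma IsIET.finite_discontinuities (h : IsIET s l r len π T) :
    {w | ¬ ContinuousAt T w}.Finite := by
  refine ((finite_range (sepPt l len)).insert r).subset fun w hw => ?_
  by_contra hc
  simp only [mem_insert_iff, mem_range, not_or, not_exists] at hc
  exact hw (h.continuousAt hc.1 fun i => Ne.symm (hc.2 i))

end Exchange
section LastVisit

variable {T : Equiv.Perm ℝ} {u v : ℝ}

/-- `p` is the most recent point of `(u, v)` in the past orbit of `x` (which may be `x` itself). -/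
def LastVisit (T : Equiv.Perm ℝ) (u v p x : ℝ) : Prop :=
  p ∈ Ioo u v ∧ ∃ n : ℕ, (T ^ n) p = x ∧ ∀ k, 0 < k → k ≤ n → (T ^ k) p ∉ Ioo u v

lemma pow_sub_apply {m n : ℕ} (h : m ≤ n) {y z : ℝ} (hyz : (T ^ n) y = (T ^ m) z) :
    (T ^ (n - m)) y = z := by
  apply (T ^ m).injective
  rw [← Equiv.Perm.mul_apply, ← pow_add, Nat.add_sub_cancel' h, hyz]

lemma LastVisit.unique {p q x : ℝ} (hp : LastVisit T u v p x) (hq : LastVisit T u v q x) :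
    p = q := by
  obtain ⟨hpI, n, hn, hn'⟩ := hp
  obtain ⟨hqI, m, hm, hm'⟩ := hq
  rcases lt_trichotomy n m with h | h | h
  · have := pow_sub_apply h.le (hm.trans hn.symm)
    exact absurd (this ▸ hpI) (hm' (m - n) (by omega) (by omega))
  · subst h
    exact (T ^ n).injective (hn.trans hm.symm)
  · have := pow_sub_apply h.le (hn.trans hm.symm)
    exact absurd (this ▸ hqI) (hn' (n - m) (by omega) (by omega))

lemma LastVisit.self {p : ℝ} (hp : p ∈ Ioo u v) : LastVisit T u v p p :=
  ⟨hp, 0, rfl, fun k h1 h2 => by omega⟩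

lemma LastVisit.mem_orbitZ {p x : ℝ} (h : LastVisit T u v p x) : x ∈ orbitZ T p := by
  obtain ⟨-, n, hn, -⟩ := h
  exact ⟨n, by rwa [zpow_natCast]⟩

/-- If `T x = y` and `y` is outside `(u, v)`, then `x` and `y` have the same last visit. -/
lemma LastVisit.of_apply {p x : ℝ} (h : LastVisit T u v p (T x)) (hne : p ≠ T x) :
    LastVisit T u v p x := by
  obtain ⟨hp, n, hn, hn'⟩ := h
  rcases n with _ | n
  · exact absurd hn hne
  · refine ⟨hp, n, T.injective ?_, fun k h1 h2 => hn' k h1 (by omega)⟩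
    rw [← hn, pow_succ', Equiv.Perm.mul_apply]

lemma finite_lastVisit {Q : Set ℝ} (hQ : Q.Finite) :
    {p | ∃ x ∈ Q, LastVisit T u v p x}.Finite := by
  have : {p | ∃ x ∈ Q, LastVisit T u v p x} = ⋃ x ∈ Q, {p | LastVisit T u v p x} := by
    ext p
    simp
  rw [this]
  exact hQ.biUnion fun x _ => Set.Subsingleton.finite fun p hp q hq => hp.unique hq

end LastVisit

section Return

variable {s : ℕ} {l r : ℝ} {len : Fin s → ℝ} {π : Equiv.Perm (Fin s)} {T : Equiv.Perm ℝ} {u v : ℝ}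

/-- The iterates of a semi-interval in `[u, v)` cannot all be translates missing `[u, v)`. -/
lemma IsIET.exists_return_of_translates (h : IsIET s l r len π T) (hlu : l ≤ u) (hvr : v ≤ r)
    {a b : ℝ} (hab : a < b) (hsub : Ico a b ⊆ Ico u v) {c : ℕ → ℝ}
    (hc : ∀ m, ∀ z ∈ Ico a b, (T ^ m) z = z + c m) :
    ∃ k, 0 < k ∧ ∃ z ∈ Ico a b, (T ^ k) z ∈ Ico u v := by
  have ha : a ∈ Ico a b := ⟨le_rfl, hab⟩
  have hmem : ∀ m, a + c m ∈ Ico l r := fun m => by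
    rw [← hc m a ha]
    exact h.pow_apply_mem (Ico_subset_Ico hlu hvr (hsub ha)) m
  have hd : 0 < b - a := sub_pos.2 hab
  have hmaps : MapsTo (fun m : ℕ => ⌊(a + c m) / (b - a)⌋) univ
      (Icc ⌊l / (b - a)⌋ ⌊r / (b - a)⌋) := fun m _ =>
    ⟨Int.floor_le_floor (by gcongr; exact (hmem m).1),
      Int.floor_le_floor (by gcongr; exact (hmem m).2.le)⟩
  obtain ⟨m, -, n, -, hmn, hfl⟩ :=
    infinite_univ.exists_lt_map_eq_of_mapsTo hmaps (finite_Icc _ _)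
  have habs := Int.abs_sub_lt_one_of_floor_eq_floor hfl
  rw [← sub_div, abs_div, abs_of_pos hd, div_lt_one hd, abs_lt] at habs
  refine ⟨n - m, by omega, ?_⟩
  rcases le_total (c m) (c n) with hle | hle
  · have hz : a + (c n - c m) ∈ Ico a b := ⟨by linarith, by linarith [habs.1]⟩
    refine ⟨a, ha, ?_⟩
    rw [pow_sub_apply hmn.le (z := a + (c n - c m))]
    · exact hsub hz
    · rw [hc n a ha, hc m _ hz]
      ring
  · have hz : a + (c m - c n) ∈ Ico a b := ⟨by linarith, by linarith [habs.2]⟩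
    refine ⟨_, hz, ?_⟩
    rw [pow_sub_apply hmn.le (z := a)]
    · exact hsub ha
    · rw [hc n _ hz, hc m a ha]
      ring

/-- The first return map to `[u, v)` is a translation on each semi-interval whose interior contains
no last visit before a separation point or an endpoint. -/
lemma IsIET.exists_return_cell (h : IsIET s l r len π T) (hlu : l ≤ u) (hvr : v ≤ r)
    {a b : ℝ} (hab : a < b) (hsub : Ico a b ⊆ Ico u v)
    (hF : ∀ z ∈ Ioo a b, ∀ x, LastVisit T u v z x → x ≠ u ∧ x ≠ v ∧ ∀ i, x ≠ sepPt l len i) :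
    ∃ n, 0 < n ∧ ∃ c, (∀ z ∈ Ico a b, (T ^ n) z = z + c) ∧ (∀ z ∈ Ico a b, z + c ∈ Ico u v) ∧
      ∀ k, 0 < k → k < n → ∀ z ∈ Ico a b, (T ^ k) z ∉ Ico u v := by
  by_contra hno
  have ha : a ∈ Ico a b := ⟨le_rfl, hab⟩
  have hu : u ≤ a := (hsub ha).1
  have hv : b ≤ v := by
    by_contra! hlt
    exact lt_irrefl _ (hsub (show v ∈ Ico a b from ⟨(hsub ha).2.le, hlt⟩)).2
  have hIoo : ∀ z ∈ Ioo a b, z ∈ Ioo u v := fun z hz => ⟨hu.trans_lt hz.1, hz.2.trans_le hv⟩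
  have hdisj : ∀ m c, 0 < m → (∀ z ∈ Ico a b, (T ^ m) z = z + c) →
      (∀ k, 0 < k → k < m → ∀ z ∈ Ico a b, (T ^ k) z ∉ Ico u v) →
      ∀ z ∈ Ico a b, z + c ∉ Ico u v := by
    intro m c hm hc hk z hz hzc
    have key : ∀ x, x - c ∈ Ioo a b → x ∉ Ioo u v → LastVisit T u v (x - c) x := by
      intro x hx hxI
      have hT : (T ^ m) (x - c) = x := by
        rw [hc _ (Ioo_subset_Ico_self hx)]
        ring
      refine ⟨hIoo _ hx, m, hT, fun k h0 hkm hmem => ?_⟩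
      rcases hkm.lt_or_eq with hlt | rfl
      · exact hk k h0 hlt _ (Ioo_subset_Ico_self hx) (Ioo_subset_Ico_self hmem)
      · exact hxI (hT ▸ hmem)
    have h1 : u ≤ a + c := by
      by_contra! hlt
      have hx : u - c ∈ Ioo a b := ⟨by linarith, by linarith [hzc.1, hz.2]⟩
      exact (hF _ hx u (key u hx fun h => lt_irrefl _ h.1)).1 rfl
    have h2 : b + c ≤ v := by
      by_contra! hlt
      have hx : v - c ∈ Ioo a b := ⟨by linarith [hzc.2, hz.1], by linarith⟩
      exact (hF _ hx v (key v hx fun h => lt_irrefl _ h.2)).2.1 rfl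
    exact hno ⟨m, hm, c, hc, fun z hz => ⟨by linarith [hz.1], by linarith [hz.2]⟩, hk⟩
  have hall : ∀ m, ∃ c, (∀ z ∈ Ico a b, (T ^ m) z = z + c) ∧
      ∀ k, 0 < k → k < m → ∀ z ∈ Ico a b, (T ^ k) z ∉ Ico u v := by
    intro m
    induction m with
    | zero => exact ⟨0, by simp, fun k h1 h2 => by omega⟩
    | succ m ih =>
      obtain ⟨c, hc, hk⟩ := ih
      have hk' : ∀ k, 0 < k → k < m + 1 → ∀ z ∈ Ico a b, (T ^ k) z ∉ Ico u v := by
        intro k h0 hkm z hz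
        rcases (Nat.lt_succ_iff.1 hkm).lt_or_eq with hlt | rfl
        · exact hk k h0 hlt z hz
        · rw [hc z hz]
          exact hdisj k c h0 hc hk z hz
      have hmem : ∀ z ∈ Ico a b, z + c ∈ Ico l r := fun z hz => by
        rw [← hc z hz]
        exact h.pow_apply_mem (Ico_subset_Ico hlu hvr (hsub hz)) m
      obtain ⟨i, hi⟩ := h.exists_cell (hmem a ha)
      have hb : b + c ≤ sepPt l len i + len i := by
        by_contra! hlt
        have hx : sepPt l len i + len i - c ∈ Ioo a b := ⟨by linarith [hi.2], by linarith⟩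
        have hx' := Ioo_subset_Ico_self hx
        have hvis : LastVisit T u v (sepPt l len i + len i - c) (sepPt l len i + len i) := by
          refine ⟨hIoo _ hx, m, by rw [hc _ hx']; ring, fun k h0 hkm hkI => ?_⟩
          exact hk' k h0 (by omega) _ hx' (Ioo_subset_Ico_self hkI)
        by_cases hlast : (i : ℕ) + 1 = s
        · have := (hmem _ hx').2
          rw [sepPt_add_of_last hlast, h.total] at this
          linarith
        · exact (hF _ hx _ hvis).2.2 ⟨i + 1, by omega⟩ (sepPt_eq_add rfl).symm
      refine ⟨c + (imgPt l len π i - sepPt l len i), fun z hz => ?_, hk'⟩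
      rw [pow_succ', Equiv.Perm.mul_apply, hc z hz, h.2.2.2.2 i _
        ⟨by linarith [hi.1, hz.1], by linarith [hz.2]⟩]
      ring
  choose c hc hk using hall
  obtain ⟨k, h0, z, hz, hkz⟩ := h.exists_return_of_translates hlu hvr hab hsub hc
  exact hk (k + 1) k h0 (by omega) z hz hkz

/-- If the finite set `F` contains all last visits before separation points and endpoints, the
first return map to `[u, v)` is a translation on each of the cells delimited by `F`. -/
lemma IsIET.exists_return_cells (h : IsIET s l r len π T) (hlu : l ≤ u) (huv : u < v)
    (hvr : v ≤ r) (F : Finset ℝ) (hFI : ∀ x ∈ F, x ∈ Ioo u v)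
    (hF : ∀ z x, LastVisit T u v z x → (x = u ∨ x = v ∨ ∃ i, x = sepPt l len i) → z ∈ F)
    {k : ℕ} (hk : F.card + 1 = k) :
    ∃ lam : Fin k → ℝ, (∀ i, 0 < lam i) ∧ ∑ i, lam i = v - u ∧
      range (sepPt u lam) = insert u (F : Set ℝ) ∧
      ∀ i, ∃ n, 0 < n ∧ ∃ c, ∀ z ∈ Ico (sepPt u lam i) (sepPt u lam i + lam i),
        (T ^ n) z = z + c ∧ z + c ∈ Ico u v ∧ ∀ j, 0 < j → j < n → (T ^ j) z ∉ Ico u v := by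
  obtain ⟨lam, hpos, hsum, hrange⟩ := exists_lengths huv F hFI hk
  refine ⟨lam, hpos, hsum, hrange, fun i => ?_⟩
  have hsub : Ico (sepPt u lam i) (sepPt u lam i + lam i) ⊆ Ico u v := by
    refine Ico_subset_Ico (le_sepPt hpos i) ?_
    linarith [sepPt_add_le_total (l := u) hpos i]
  obtain ⟨n, hn, c, h1, h2, h3⟩ :=
    h.exists_return_cell hlu hvr (by linarith [hpos i]) hsub (fun z hz x hx => by
      have hzF : z ∉ F := by
        intro hzF
        obtain ⟨j, rfl⟩ : z ∈ range (sepPt u lam) := hrange ▸ mem_insert_of_mem _ hzF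
        exact sepPt_notMem_Ioo hpos i j hz
      refine ⟨fun hu => hzF (hF z x hx (.inl hu)), fun hv => hzF (hF z x hx (.inr (.inl hv))),
        fun j hj => hzF (hF z x hx (.inr (.inr ⟨j, hj⟩)))⟩)
  exact ⟨n, hn, c, fun z hz => ⟨h1 z hz, h2 z hz, fun j h0 hj => h3 j h0 hj z hz⟩⟩

/-- Return times to `[u, v)` are bounded. -/
lemma IsIET.exists_return_bound (h : IsIET s l r len π T) (hlu : l ≤ u) (huv : u < v)
    (hvr : v ≤ r) : ∃ N, ∀ z ∈ Ico u v, ∃ n, 0 < n ∧ n ≤ N ∧ (T ^ n) z ∈ Ico u v := by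
  have hQ : (insert u (insert v (range (sepPt l len)))).Finite :=
    ((finite_range _).insert v).insert u
  have hfin := finite_lastVisit (T := T) (u := u) (v := v) hQ
  obtain ⟨lam, hpos, hsum, -, hcell⟩ := h.exists_return_cells hlu huv hvr hfin.toFinset
    (fun x hx => by
      obtain ⟨y, -, hy⟩ := hfin.mem_toFinset.1 hx
      exact hy.1)
    (fun z x hzx hx => hfin.mem_toFinset.2 ⟨x, by
      simp only [mem_insert_iff, mem_range]
      rcases hx with hx | hx | ⟨i, hi⟩
      exacts [.inl hx, .inr (.inl hx), .inr (.inr ⟨i, hi.symm⟩)], hzx⟩) rfl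
  choose n hn c hc using hcell
  refine ⟨Finset.univ.sup n, fun z hz => ?_⟩
  obtain ⟨i, hi⟩ := exists_mem_cell (l := u) (len := lam) (z := z) (by
    rwa [hsum, add_sub_cancel])
  obtain ⟨h1, h2, -⟩ := hc i z hi
  exact ⟨n i, hn i, Finset.le_sup (Finset.mem_univ i), h1 ▸ h2⟩

end Return
section Orbit

variable {T : Equiv.Perm ℝ}

lemma perm_inv_apply_self (T : Equiv.Perm ℝ) (z : ℝ) : T⁻¹ (T z) = z := T.symm_apply_apply z

lemma perm_apply_inv_self (T : Equiv.Perm ℝ) (z : ℝ) : T (T⁻¹ z) = z := T.apply_symm_apply z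

lemma mem_orbitZ_self (z : ℝ) : z ∈ orbitZ T z := ⟨0, rfl⟩

lemma pow_mem_orbitZ (n : ℕ) (z : ℝ) : (T ^ n) z ∈ orbitZ T z := ⟨n, by rw [zpow_natCast]⟩

lemma orbitZ_eq_of_mem {w z : ℝ} (h : w ∈ orbitZ T z) : orbitZ T w = orbitZ T z := by
  obtain ⟨n, rfl⟩ := h
  ext x
  constructor
  · rintro ⟨m, rfl⟩
    exact ⟨m + n, by rw [zpow_add, Equiv.Perm.mul_apply]⟩
  · rintro ⟨m, rfl⟩
    exact ⟨m - n, by rw [← Equiv.Perm.mul_apply, ← zpow_add, sub_add_cancel]⟩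

lemma orbitZ_infinite_iff {z : ℝ} : (orbitZ T z).Infinite ↔ ∀ n : ℕ, 0 < n → (T ^ n) z ≠ z := by
  constructor
  · intro hinf n hn hz
    refine hinf (((finite_Iio n).image fun k : ℕ => (T ^ k) z).subset ?_)
    rintro _ ⟨m, rfl⟩
    have hn' : (0 : ℤ) < n := by exact_mod_cast hn
    refine ⟨(m % n).toNat, ?_, ?_⟩
    · have := Int.emod_lt_of_pos m hn'
      have := Int.emod_nonneg m hn'.ne'
      simp only [mem_Iio]
      omega
    · have h0 : ((m % n).toNat : ℤ) = m % n := Int.toNat_of_nonneg (Int.emod_nonneg m hn'.ne')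
      have hm : T ^ m = T ^ (m % n) * (T ^ n) ^ (m / n) := by
        rw [← zpow_natCast, ← zpow_mul, ← zpow_add, Int.emod_add_mul_ediv]
      simp only
      rw [hm, Equiv.Perm.mul_apply, Equiv.Perm.zpow_apply_eq_self_of_apply_eq_self hz,
        ← zpow_natCast, h0]
  · intro h
    refine (infinite_range_of_injective (f := fun n : ℕ => (T ^ n) z) fun m n hmn => ?_).mono ?_
    · rcases lt_trichotomy m n with hlt | heq | hlt
      · exact absurd (pow_sub_apply hlt.le hmn.symm) (h _ (by omega))
      · exact heq
      · exact absurd (pow_sub_apply hlt.le hmn) (h _ (by omega))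
    · rintro _ ⟨n, rfl⟩
      exact pow_mem_orbitZ n z

end Orbit

section Minimality

variable {s : ℕ} {l r : ℝ} {len : Fin s → ℝ} {π : Equiv.Perm (Fin s)} {T : Equiv.Perm ℝ}

lemma IsIET.exists_apply_sepPt_eq_left (h : IsIET s l r len π T) :
    ∃ q, T (sepPt l len q) = l := by
  obtain ⟨i, -⟩ := h.exists_cell ⟨le_rfl, h.1⟩
  refine ⟨π.symm ⟨0, i.pos⟩, ?_⟩
  rw [← h.sepPt_inv, sepPt_of_val_eq_zero rfl]

/-- The left endpoint is the image of a nonzero separation point. -/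
lemma IsIET.exists_nonzero_apply_sepPt_eq_left (hs : 2 ≤ s) (h : IsIET s l r len π T)
    (hreg : IsRegularIET s l len T) : ∃ q : Fin s, (q : ℕ) ≠ 0 ∧ T (sepPt l len q) = l := by
  obtain ⟨q, hq⟩ := h.exists_apply_sepPt_eq_left
  refine ⟨q, fun hq0 => ?_, hq⟩
  have hπ : π q = ⟨0, by omega⟩ := by
    by_contra hne
    have := lt_sepPt (l := l) h.inv.2.1 (i := π q) (fun h0 => hne (Fin.ext h0))
    rw [h.sepPt_inv, Equiv.symm_apply_apply, hq] at this
    exact lt_irrefl _ this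
  let j : Fin s := π.symm ⟨1, by omega⟩
  have hj : (j : ℕ) ≠ 0 := by
    intro hj0
    have hjq : j = q := Fin.ext (hj0.trans hq0.symm)
    have : π j = ⟨1, by omega⟩ := Equiv.apply_symm_apply _ _
    rw [hjq, hπ] at this
    simp at this
  have hone : T (sepPt l len j) = sepPt l len ⟨1, by omega⟩ := by
    rw [← h.sepPt_inv, sepPt_eq_add (i := ⟨0, by omega⟩) rfl,
      sepPt_eq_add (i := ⟨0, by omega⟩) (j := ⟨1, by omega⟩) rfl,
      sepPt_of_val_eq_zero rfl, sepPt_of_val_eq_zero rfl, Function.comp_apply, ← hπ,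
      Equiv.symm_apply_apply, hπ]
    congr 2
    exact Fin.ext hq0
  by_cases hj1 : j = ⟨1, by omega⟩
  · rw [hj1] at hone
    exact orbitZ_infinite_iff.1 (hreg.1 ⟨1, by omega⟩ (by simp)) 1 one_pos (by simpa using hone)
  · refine disjoint_left.1 (hreg.2 j ⟨1, by omega⟩ hj (by simp) hj1) ?_ (mem_orbitZ_self _)
    rw [← hone]
    exact pow_mem_orbitZ 1 _

/-- No separation point is mapped to a nonzero separation point by a positive iterate. -/
lemma IsIET.pow_apply_sepPt_ne (hs : 2 ≤ s) (h : IsIET s l r len π T)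
    (hreg : IsRegularIET s l len T) {n : ℕ} (hn : 0 < n) (j : Fin s) {i : Fin s}
    (hi : (i : ℕ) ≠ 0) : (T ^ n) (sepPt l len j) ≠ sepPt l len i := by
  have key : ∀ n, 0 < n → ∀ j : Fin s, (j : ℕ) ≠ 0 → (T ^ n) (sepPt l len j) ≠ sepPt l len i := by
    intro n hn j hj heq
    by_cases hij : j = i
    · subst hij
      exact orbitZ_infinite_iff.1 (hreg.1 j hj) n hn heq
    · exact disjoint_left.1 (hreg.2 j i hj hi hij) (heq ▸ pow_mem_orbitZ n _) (mem_orbitZ_self _)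
  by_cases hj : (j : ℕ) = 0
  · obtain ⟨q, hq, hql⟩ := h.exists_nonzero_apply_sepPt_eq_left hs hreg
    have hj' : sepPt l len j = T (sepPt l len q) := (sepPt_of_val_eq_zero hj).trans hql.symm
    rw [hj', ← Equiv.Perm.mul_apply, ← pow_succ]
    exact key (n + 1) (by omega) q hq
  · exact key n hn j hj

/-- A regular interval exchange transformation has no periodic points. -/
lemma IsIET.pow_apply_ne (hs : 2 ≤ s) (h : IsIET s l r len π T)
    (hreg : IsRegularIET s l len T) {z : ℝ} (hz : z ∈ Ico l r) {n : ℕ} (hn : 0 < n) :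
    (T ^ n) z ≠ z := by
  intro hper
  choose i hi using fun k : ℕ => h.exists_cell (h.pow_apply_mem hz k)
  obtain ⟨k, hk, hmin⟩ := Finset.exists_min_image (Finset.range n)
    (fun k => (T ^ k) z - sepPt l len (i k)) ⟨0, Finset.mem_range.2 hn⟩
  set t := (T ^ k) z - sepPt l len (i k) with ht
  have ht0 : 0 ≤ t := sub_nonneg.2 (hi k).1
  have hshift : ∀ m, m ≤ n → (T ^ m) (z - t) = (T ^ m) z - t := by
    intro m
    induction m with
    | zero => simp
    | succ m ih =>
      intro hm
      have hmk := hmin m (Finset.mem_range.2 hm)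
      rw [pow_succ', Equiv.Perm.mul_apply, Equiv.Perm.mul_apply, ih (by omega),
        h.2.2.2.2 (i m) _ (hi m), h.2.2.2.2 (i m) _ ⟨by linarith, by linarith [(hi m).2]⟩]
      ring
  have hper' : (T ^ n) (z - t) = z - t := by rw [hshift n le_rfl, hper]
  have hsep : (T ^ n) (sepPt l len (i k)) = sepPt l len (i k) := by
    have : sepPt l len (i k) = (T ^ k) (z - t) := by
      rw [hshift k (Finset.mem_range.1 hk).le]
      ring
    rw [this, ← Equiv.Perm.mul_apply, ← pow_add, add_comm, pow_add, Equiv.Perm.mul_apply, hper']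
  by_cases h0 : (i k : ℕ) = 0
  · obtain ⟨q, hq, hql⟩ := h.exists_nonzero_apply_sepPt_eq_left hs hreg
    refine h.pow_apply_sepPt_ne hs hreg hn q hq (T.injective ?_)
    rw [sepPt_of_val_eq_zero h0] at hsep
    rw [← Equiv.Perm.mul_apply, ← pow_succ', pow_succ, Equiv.Perm.mul_apply, hql, hsep]
  · exact h.pow_apply_sepPt_ne hs hreg hn _ h0 hsep

lemma apply_mem_frontier {A : Set ℝ} {w : ℝ} (hT : ContinuousAt T w)
    (hA : ∀ z, z ∈ A → T z ∈ A) (hA' : ∀ z, z ∉ A → T z ∉ A) (hw : w ∈ frontier A) :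
    T w ∈ frontier A := by
  rw [frontier_eq_closure_inter_closure] at hw ⊢
  exact ⟨hT.continuousWithinAt.mem_closure hw.1 hA, hT.continuousWithinAt.mem_closure hw.2 hA'⟩

/-- The forward orbit of a boundary point of an invariant set with finite boundary meets the
separation points. -/
lemma IsIET.exists_pow_apply_eq_sepPt (h : IsIET s l r len π T)
    (hper : ∀ z ∈ Ico l r, ∀ n : ℕ, 0 < n → (T ^ n) z ≠ z) {A : Set ℝ}
    (hA : ∀ z, z ∈ A → T z ∈ A) (hA' : ∀ z, z ∉ A → T z ∉ A) (hfin : (frontier A).Finite)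
    {w : ℝ} (hw : w ∈ frontier A) (hwI : w ∈ Ioo l r) :
    ∃ (n : ℕ) (i : Fin s), (T ^ n) w = sepPt l len i ∧ (T ^ n) w ≠ l := by
  by_contra! hno
  have hall : ∀ n : ℕ, (T ^ n) w ∈ frontier A ∧ (T ^ n) w ∈ Ioo l r := by
    intro n
    induction n with
    | zero => exact ⟨hw, hwI⟩
    | succ n ih =>
      have hsep : ∀ i, (T ^ n) w ≠ sepPt l len i := fun i hi => ih.2.1.ne' (hno n i hi)
      rw [pow_succ', Equiv.Perm.mul_apply]
      refine ⟨apply_mem_frontier (h.continuousAt ih.2.2.ne hsep) hA hA' ih.1, ?_⟩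
      have hmem := h.apply_mem (Ioo_subset_Ico_self ih.2)
      refine ⟨lt_of_le_of_ne hmem.1 fun heq => ?_, hmem.2⟩
      obtain ⟨q, hq⟩ := h.exists_apply_sepPt_eq_left
      exact hsep q (T.injective (heq.symm.trans hq.symm))
  refine orbitZ_infinite_iff.2 (hper w (Ioo_subset_Ico_self hwI)) ?_
  have hinj : Function.Injective fun n : ℕ => (T ^ n) w := by
    intro m n hmn
    rcases lt_trichotomy m n with hlt | heq | hlt
    · exact absurd (pow_sub_apply hlt.le hmn.symm)
        (hper w (Ioo_subset_Ico_self hwI) _ (by omega))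
    · exact heq
    · exact absurd (pow_sub_apply hlt.le hmn)
        (hper w (Ioo_subset_Ico_self hwI) _ (by omega))
  exact absurd (hfin.subset (range_subset_iff.2 fun n => (hall n).1))
    (infinite_range_of_injective hinj)

lemma IsIET.finite_frontier_preimage (h : IsIET s l r len π T) {X : Set ℝ}
    (hX : (frontier X).Finite) : (frontier (T ⁻¹' X)).Finite := by
  refine (h.finite_discontinuities.union (hX.preimage T.injective.injOn)).subset fun w hw => ?_
  by_cases hc : ContinuousAt T w
  · refine .inr ?_
    rw [frontier_eq_closure_inter_closure] at hw
    rw [mem_preimage, frontier_eq_closure_inter_closure]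
    exact ⟨hc.continuousWithinAt.mem_closure hw.1 fun z hz => hz,
      hc.continuousWithinAt.mem_closure hw.2 fun z hz => hz⟩
  · exact .inl hc

lemma IsIET.finite_frontier_iterates (h : IsIET s l r len π T) {X : Set ℝ}
    (hX : (frontier X).Finite) (N : ℕ) :
    (frontier {z | ∃ k, k ≤ N ∧ (T ^ k) z ∈ X}).Finite := by
  induction N with
  | zero => simpa using hX
  | succ N ih =>
    have : {z | ∃ k, k ≤ N + 1 ∧ (T ^ k) z ∈ X}
        = X ∪ T ⁻¹' {z | ∃ k, k ≤ N ∧ (T ^ k) z ∈ X} := by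
      ext z
      simp only [mem_ofPred_eq, mem_union, mem_preimage, ← Equiv.Perm.mul_apply, ← pow_succ]
      constructor
      · rintro ⟨k, hk, hz⟩
        rcases k with _ | k
        · exact .inl hz
        · exact .inr ⟨k, by omega, hz⟩
      · rintro (hz | ⟨k, hk, hz⟩)
        · exact ⟨0, by omega, hz⟩
        · exact ⟨k + 1, by omega, hz⟩
    rw [this]
    refine (hX.union (h.finite_frontier_preimage ih)).subset ((frontier_union_subset _ _).trans ?_)
    exact union_subset_union inter_subset_left inter_subset_right

/-- Every point reaches a given semi-interval in bounded time under the inverse map. -/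
lemma IsIET.exists_inv_pow_mem_Ico (hs : 2 ≤ s) (h : IsIET s l r len π T)
    (hreg : IsRegularIET s l len T) {u v : ℝ} (hlu : l ≤ u) (huv : u < v) (hvr : v ≤ r) :
    ∃ N, ∀ z ∈ Ico l r, ∃ k, k ≤ N ∧ (T⁻¹ ^ k) z ∈ Ico u v := by
  obtain ⟨N₁, hN₁⟩ := h.exists_return_bound hlu huv hvr
  obtain ⟨N₂, hN₂⟩ := h.inv.exists_return_bound hlu huv hvr
  set A := {z | ∃ k, k ≤ max N₁ N₂ ∧ (T⁻¹ ^ k) z ∈ Ico u v} with hA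
  have hfr : (frontier A).Finite := by
    refine h.inv.finite_frontier_iterates ?_ _
    rw [frontier_Ico huv]
    exact (finite_singleton v).insert u
  have hforw : ∀ z, z ∈ A → T z ∈ A := by
    rintro z ⟨k, hk, hz⟩
    rcases hk.lt_or_eq with hlt | heq
    · exact ⟨k + 1, hlt, by rwa [pow_succ, Equiv.Perm.mul_apply, perm_inv_apply_self]⟩
    · obtain ⟨n, hn0, hn, hmem⟩ := hN₁ _ hz
      have hle : n ≤ k := heq ▸ hn.trans (le_max_left _ _)
      refine ⟨k + 1 - n, by omega, ?_⟩
      rw [pow_sub_apply (m := n) (by omega) (z := (T ^ n) ((T⁻¹ ^ k) z))]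
      · exact hmem
      · rw [pow_succ, Equiv.Perm.mul_apply, perm_inv_apply_self, inv_pow T n,
          perm_inv_apply_self]
  have hback : ∀ z, z ∈ A → T⁻¹ z ∈ A := by
    rintro z ⟨k, hk, hz⟩
    rcases k with _ | k
    · obtain ⟨n, hn0, hn, hmem⟩ := hN₂ z hz
      obtain ⟨m, rfl⟩ := Nat.exists_eq_succ_of_ne_zero hn0.ne'
      refine ⟨m, ?_, by rwa [pow_succ, Equiv.Perm.mul_apply] at hmem⟩
      have := hn.trans (le_max_right N₁ N₂)
      omega
    · exact ⟨k, by omega, by rwa [pow_succ, Equiv.Perm.mul_apply] at hz⟩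
  have hper : ∀ z ∈ Ico l r, ∀ n : ℕ, 0 < n → (T ^ n) z ≠ z :=
    fun z hz n hn => h.pow_apply_ne hs hreg hz hn
  have hper' : ∀ z ∈ Ico l r, ∀ n : ℕ, 0 < n → (T⁻¹ ^ n) z ≠ z := by
    intro z hz n hn hzn
    rw [inv_pow, Equiv.Perm.inv_eq_iff_eq] at hzn
    exact hper z hz n hn hzn.symm
  have hempty : ∀ w ∈ Ioo l r, w ∉ frontier A := by
    intro w hwI hw
    obtain ⟨n, i, hi, hil⟩ := h.exists_pow_apply_eq_sepPt hper hforw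
      (fun z hz hz' => hz (by simpa using hback _ hz')) hfr hw hwI
    obtain ⟨m, j, hj, -⟩ := h.inv.exists_pow_apply_eq_sepPt hper' hback
      (fun z hz hz' => hz (by simpa using hforw _ hz')) hfr hw hwI
    rw [h.sepPt_inv, inv_pow, Equiv.Perm.inv_eq_iff_eq] at hj
    have hi0 : (i : ℕ) ≠ 0 := fun h0 => hil (hi.trans (sepPt_of_val_eq_zero h0))
    refine h.pow_apply_sepPt_ne hs hreg (n := n + m + 1) (by omega) (π.symm j) hi0 ?_
    rw [pow_succ, pow_add, Equiv.Perm.mul_apply, Equiv.Perm.mul_apply, ← hj, hi]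
  have hIoo : Ioo l r ⊆ A := by
    have hcover : Ioo l r ⊆ interior A ∪ interior Aᶜ := by
      rw [← compl_frontier_eq_union_interior]
      exact hempty
    have hm : Ioo u v ⊆ interior A :=
      interior_maximal (fun z hz => ⟨0, by omega, Ioo_subset_Ico_self hz⟩) isOpen_Ioo
    have hmid : (u + v) / 2 ∈ Ioo u v := ⟨by linarith, by linarith⟩
    exact (isPreconnected_Ioo.subset_left_of_subset_union isOpen_interior isOpen_interior
      (disjoint_compl_right.mono interior_subset interior_subset) hcover
      ⟨_, ⟨by linarith, by linarith⟩, hm hmid⟩).trans interior_subset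
  refine ⟨max N₁ N₂, fun z hz => ?_⟩
  change z ∈ A
  rcases hz.1.lt_or_eq with hlt | rfl
  · exact hIoo ⟨hlt, hz.2⟩
  · have hmem := h.apply_mem hz
    have hne : T l ≠ l := by simpa using hper l hz 1 one_pos
    simpa using hback _ (hIoo ⟨lt_of_le_of_ne hmem.1 hne.symm, hmem.2⟩)

lemma IsIET.exists_inv_pow_mem_Ioo (hs : 2 ≤ s) (h : IsIET s l r len π T)
    (hreg : IsRegularIET s l len T) {u v : ℝ} (hlu : l ≤ u) (huv : u < v) (hvr : v ≤ r) :
    ∃ N, ∀ z ∈ Ico l r, ∃ k, k ≤ N ∧ (T⁻¹ ^ k) z ∈ Ioo u v := by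
  obtain ⟨N, hN⟩ := h.exists_inv_pow_mem_Ico hs hreg (u := (u + v) / 2) (v := v)
    (by linarith) (by linarith) hvr
  refine ⟨N, fun z hz => ?_⟩
  obtain ⟨k, hk, hkI⟩ := hN z hz
  exact ⟨k, hk, by linarith [hkI.1], hkI.2⟩

lemma IsIET.exists_pow_mem_Ioo (hs : 2 ≤ s) (h : IsIET s l r len π T)
    (hreg : IsRegularIET s l len T) {u v : ℝ} (hlu : l ≤ u) (huv : u < v) (hvr : v ≤ r)
    {z : ℝ} (hz : z ∈ Ico l r) : ∃ n, 0 < n ∧ (T ^ n) z ∈ Ioo u v := by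
  obtain ⟨N, hN⟩ := h.exists_inv_pow_mem_Ioo hs hreg hlu huv hvr
  obtain ⟨k, hk, hkI⟩ := hN _ (h.pow_apply_mem hz (N + 1))
  refine ⟨N + 1 - k, by omega, ?_⟩
  convert hkI using 1
  refine pow_sub_apply (by omega) ?_
  rw [inv_pow, perm_apply_inv_self]

end Minimality
section Translations

variable {k : ℕ} {u v : ℝ} {lam : Fin k → ℝ}

lemma eq_of_mem_cells (hpos : ∀ i, 0 < lam i) {i j : Fin k} {z : ℝ}
    (hi : z ∈ Ico (sepPt u lam i) (sepPt u lam i + lam i))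
    (hj : z ∈ Ico (sepPt u lam j) (sepPt u lam j + lam j)) : i = j := by
  rcases lt_trichotomy i j with h | h | h
  · linarith [sepPt_add_le (l := u) hpos h, hi.2, hj.1]
  · exact h
  · linarith [sepPt_add_le (l := u) hpos h, hj.2, hi.1]

/-- If the translates `[e i, e i + lam i)` are pairwise disjoint in `[u, v)` and have total length
`v - u`, then they are arranged in the order of some permutation without gaps. -/
lemma exists_perm_imgPt_eq (hpos : ∀ i, 0 < lam i) (hsum : ∑ i, lam i = v - u)
    (e : Fin k → ℝ) (hsub : ∀ i, Ico (e i) (e i + lam i) ⊆ Ico u v)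
    (hdisj : ∀ i j z, z ∈ Ico (e i) (e i + lam i) → z ∈ Ico (e j) (e j + lam j) → i = j) :
    ∃ σ : Equiv.Perm (Fin k), ∀ i, imgPt u lam σ i = e i := by
  have hmem : ∀ i, e i ∈ Ico (e i) (e i + lam i) := fun i => ⟨le_rfl, by linarith [hpos i]⟩
  have hinj : Function.Injective e := fun i j hij => hdisj i j (e i) (hmem i) (hij ▸ hmem j)
  have hmono : StrictMono (e ∘ Tuple.sort e) :=
    (Tuple.monotone_sort e).strictMono_of_injective (hinj.comp (Tuple.sort e).injective)
  have hlt : ∀ i j, (Tuple.sort e).symm i < (Tuple.sort e).symm j ↔ e i < e j := fun i j => by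
    rw [← hmono.lt_iff_lt]
    simp
  have hle : ∀ i j, e j < e i → e j + lam j ≤ e i := by
    intro i j hji
    by_contra! hc
    have := hdisj j i (e i) ⟨hji.le, hc⟩ (hmem i)
    subst this
    exact lt_irrefl _ hji
  refine ⟨(Tuple.sort e).symm, fun i => ?_⟩
  have hpair : ∀ t : Finset (Fin k),
      (t : Set (Fin k)).PairwiseDisjoint fun i => Ico (e i) (e i + lam i) :=
    fun t a _ b _ hab => disjoint_left.2 fun z ha hb => hab (hdisj a b z ha hb)
  have hsplit := Finset.sum_filter_add_sum_filter_not (Finset.univ : Finset (Fin k))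
    (fun j => (Tuple.sort e).symm j < (Tuple.sort e).symm i) lam
  have h1 := sum_le_of_disjoint_Ico
    (Finset.univ.filter fun j => (Tuple.sort e).symm j < (Tuple.sort e).symm i) e lam
    (hsub i (hmem i)).1 (fun j _ => (hpos j).le) (fun j hj z hz => by
      rw [Finset.mem_filter, hlt] at hj
      exact ⟨(hsub j hz).1, hz.2.trans_le (hle i j hj.2)⟩) (hpair _)
  have h2 := sum_le_of_disjoint_Ico
    (Finset.univ.filter fun j => ¬ (Tuple.sort e).symm j < (Tuple.sort e).symm i) e lam
    (hsub i (hmem i)).2.le (fun j _ => (hpos j).le) (fun j hj z hz => by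
      rw [Finset.mem_filter, hlt, not_lt] at hj
      exact ⟨hj.2.trans hz.1, (hsub j hz).2⟩) (hpair _)
  rw [imgPt]
  linarith

/-- An injective piecewise translation of `[u, v)` into itself is an interval exchange. -/
lemma exists_isIET_of_translations (huv : u < v) (hpos : ∀ i, 0 < lam i)
    (hsum : ∑ i, lam i = v - u) {f : ℝ → ℝ} {c : Fin k → ℝ}
    (hf : ∀ i, ∀ z ∈ Ico (sepPt u lam i) (sepPt u lam i + lam i), f z = z + c i)
    (hmaps : MapsTo f (Ico u v) (Ico u v)) (hinj : InjOn f (Ico u v)) :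
    ∃ (σ : Equiv.Perm (Fin k)) (S : Equiv.Perm ℝ), IsIET k u v lam σ S ∧
      ∀ z ∈ Ico u v, S z = f z := by
  have hcell : ∀ i z, z ∈ Ico (sepPt u lam i + c i) (sepPt u lam i + c i + lam i) →
      z - c i ∈ Ico (sepPt u lam i) (sepPt u lam i + lam i) := fun i z hz =>
    ⟨by linarith [hz.1], by linarith [hz.2]⟩
  have hcellI : ∀ i, Ico (sepPt u lam i) (sepPt u lam i + lam i) ⊆ Ico u v := fun i => by
    refine Ico_subset_Ico (le_sepPt hpos i) ?_
    linarith [sepPt_add_le_total (l := u) hpos i]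
  have hfsub : ∀ i z, z ∈ Ico (sepPt u lam i + c i) (sepPt u lam i + c i + lam i) →
      f (z - c i) = z := fun i z hz => by
    rw [hf i _ (hcell i z hz)]
    ring
  obtain ⟨σ, hσ⟩ := exists_perm_imgPt_eq hpos hsum (fun i => sepPt u lam i + c i)
    (fun i z hz => hfsub i z hz ▸ hmaps (hcellI i (hcell i z hz)))
    (fun i j z hi hj => by
      have heq : z - c i = z - c j := hinj (hcellI i (hcell i z hi)) (hcellI j (hcell j z hj))
        ((hfsub i z hi).trans (hfsub j z hj).symm)
      exact eq_of_mem_cells hpos (hcell i z hi) (heq ▸ hcell j z hj))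
  have hsurj : SurjOn f (Ico u v) (Ico u v) := by
    intro z hz
    obtain ⟨j, hj⟩ := exists_mem_cell (l := u) (len := lam ∘ σ.symm) (z := z) (by
      have : ∑ j, (lam ∘ σ.symm) j = v - u := hsum ▸ Equiv.sum_comp σ.symm lam
      rwa [this, add_sub_cancel])
    rw [sepPt_comp_symm, hσ] at hj
    exact ⟨_, hcellI _ (hcell _ z hj), hfsub _ z hj⟩
  classical
  have hbij : Function.Bijective ((Ico u v).piecewise f id) := by
    constructor
    · intro x y hxy
      by_cases hx : x ∈ Ico u v <;> by_cases hy : y ∈ Ico u v <;>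
        simp only [piecewise_eq_of_mem, piecewise_eq_of_notMem, hx, hy, not_false_eq_true,
          id] at hxy
      · exact hinj hx hy hxy
      · exact absurd (hxy ▸ hmaps hx) hy
      · exact absurd (hxy ▸ hmaps hy) hx
      · exact hxy
    · intro y
      by_cases hy : y ∈ Ico u v
      · obtain ⟨x, hx, rfl⟩ := hsurj hy
        exact ⟨x, by simp [hx]⟩
      · exact ⟨y, by simp [hy]⟩
  refine ⟨σ, Equiv.ofBijective _ hbij, ⟨huv, hpos, hsum, fun z hz => ?_, fun i z hz => ?_⟩,
    fun z hz => ?_⟩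
  · simp [Set.piecewise, hz]
  · rw [Equiv.ofBijective_apply, piecewise_eq_of_mem _ _ _ (hcellI i hz), hf i z hz, hσ]
    ring
  · rw [Equiv.ofBijective_apply, piecewise_eq_of_mem _ _ _ hz]

end Translations

section Neighbours

variable {T : Equiv.Perm ℝ} {u v : ℝ}

lemma inv_pow_apply_eq {m k : ℕ} (h : k ≤ m) (z : ℝ) :
    (T ^ k) ((T⁻¹ ^ m) z) = (T⁻¹ ^ (m - k)) z := by
  obtain ⟨j, rfl⟩ := Nat.exists_eq_add_of_le h
  rw [pow_add, Equiv.Perm.mul_apply, inv_pow T k, perm_apply_inv_self, Nat.add_sub_cancel_left]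

lemma lastVisit_rhoMinusPt {z : ℝ} (hz : ∃ n : ℕ, (T⁻¹ ^ n) z ∈ Ioo u v) :
    LastVisit T u v ((T⁻¹ ^ rhoMinusPt T u v z) z) z := by
  refine ⟨Nat.sInf_mem hz, rhoMinusPt T u v z, by simp, fun k h0 hk hmem => ?_⟩
  rw [inv_pow_apply_eq hk] at hmem
  have : rhoMinusPt T u v z ≤ rhoMinusPt T u v z - k := Nat.sInf_le hmem
  omega

/-- The neighbours of `z` are the points with the same last visit as `z`. -/
lemma mem_neighbours_iff {x z : ℝ} (hback : ∃ n : ℕ, (T⁻¹ ^ n) z ∈ Ioo u v)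
    (hforw : ∃ n : ℕ, 0 < n ∧ (T ^ n) z ∈ Ioo u v) :
    x ∈ neighbours T u v z ↔ ∃ p, LastVisit T u v p x ∧ LastVisit T u v p z := by
  have hplus : 0 < rhoPlusPt T u v z ∧ (T ^ rhoPlusPt T u v z) z ∈ Ioo u v := Nat.sInf_mem hforw
  constructor
  · rintro ⟨k, hk1, hk2, rfl⟩
    have hlast := lastVisit_rhoMinusPt hback
    refine ⟨_, ⟨hlast.1, (k + rhoMinusPt T u v z).toNat, ?_, fun j h0 hj hmem => ?_⟩, hlast⟩
    · rw [← zpow_natCast, Int.toNat_of_nonneg (by omega), zpow_add, Equiv.Perm.mul_apply,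
        zpow_natCast, inv_pow, perm_apply_inv_self]
    · by_cases hjm : j ≤ rhoMinusPt T u v z
      · rw [inv_pow_apply_eq hjm] at hmem
        have : rhoMinusPt T u v z ≤ rhoMinusPt T u v z - j := Nat.sInf_le hmem
        omega
      · obtain ⟨i, rfl⟩ := Nat.exists_eq_add_of_le' (not_le.1 hjm).le
        rw [pow_add, Equiv.Perm.mul_apply, inv_pow_apply_eq le_rfl, Nat.sub_self, pow_zero,
          Equiv.Perm.one_apply] at hmem
        have : rhoPlusPt T u v z ≤ i := Nat.sInf_le ⟨by omega, hmem⟩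
        omega
  · rintro ⟨p, ⟨-, n, hn, hn'⟩, -, m, hm, hm'⟩
    refine ⟨n - m, ?_, ?_, ?_⟩
    · by_contra! hlt
      have hr : (T⁻¹ ^ rhoMinusPt T u v z) z ∈ Ioo u v := Nat.sInf_mem hback
      refine hm' (m - rhoMinusPt T u v z) (by omega) (by omega) ?_
      rw [pow_sub_apply (z := (T⁻¹ ^ rhoMinusPt T u v z) z) (by omega)]
      · exact hr
      · rw [hm, inv_pow, perm_apply_inv_self]
    · by_contra! hle
      refine hn' (rhoPlusPt T u v z + m) (by omega) (by omega) ?_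
      rw [pow_add, Equiv.Perm.mul_apply, hm]
      exact hplus.2
    · rw [← hn, ← hm, ← zpow_natCast T m, ← Equiv.Perm.mul_apply, ← zpow_add, sub_add_cancel,
        zpow_natCast]

end Neighbours

section Induced

variable {T S : Equiv.Perm ℝ} {I : Set ℝ}

lemma returnTime_eq {z : ℝ} {n : ℕ} (hn : 0 < n) (hz : (T ^ n) z ∈ I)
    (hmin : ∀ j, 0 < j → j < n → (T ^ j) z ∉ I) : returnTime T I z = n := by
  refine le_antisymm (Nat.sInf_le ⟨hn, hz⟩) (le_csInf ⟨n, hn, hz⟩ fun j hj => ?_)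
  by_contra! hlt
  exact hmin j hj.1 hlt hj.2

lemma notMem_of_lt_returnTime {z : ℝ} {j : ℕ} (h0 : 0 < j) (hj : j < returnTime T I z) :
    (T ^ j) z ∉ I := fun hmem => Nat.notMem_of_lt_sInf hj ⟨h0, hmem⟩

lemma inducedMap_injOn (hret : ∀ z ∈ I, 0 < returnTime T I z) : InjOn (inducedMap T I) I := by
  intro x hx y hy hxy
  rw [inducedMap, inducedMap] at hxy
  have hx0 := hret x hx
  have hy0 := hret y hy
  rcases lt_trichotomy (returnTime T I x) (returnTime T I y) with h | h | h
  · have heq := pow_sub_apply h.le hxy.symm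
    exact absurd (heq ▸ hx) (notMem_of_lt_returnTime (by omega) (by omega))
  · rw [h] at hxy
    exact (T ^ _).injective hxy
  · have heq := pow_sub_apply h.le hxy
    exact absurd (heq ▸ hy) (notMem_of_lt_returnTime (by omega) (by omega))

lemma exists_pow_apply_eq_of_induced
    (hS : ∀ z ∈ I, S z ∈ I ∧ ∃ n : ℕ, 0 < n ∧ S z = (T ^ n) z) {z : ℝ} (hz : z ∈ I) (n : ℕ) :
    (S ^ n) z ∈ I ∧ ∃ N, n ≤ N ∧ (S ^ n) z = (T ^ N) z := by
  induction n with
  | zero => exact ⟨hz, 0, le_rfl, rfl⟩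
  | succ n ih =>
    obtain ⟨hmem, N, hN, heq⟩ := ih
    obtain ⟨hmem', m, hm, heq'⟩ := hS _ hmem
    rw [pow_succ', Equiv.Perm.mul_apply]
    exact ⟨hmem', m + N, by omega, by rw [heq', heq, pow_add, Equiv.Perm.mul_apply]⟩

lemma orbitZ_subset_of_induced (hS : ∀ z ∈ I, S z ∈ I ∧ ∃ n : ℕ, 0 < n ∧ S z = (T ^ n) z)
    (hS' : ∀ z ∈ I, S⁻¹ z ∈ I) {z : ℝ} (hz : z ∈ I) : orbitZ S z ⊆ orbitZ T z := by
  have hback : ∀ n : ℕ, (S⁻¹ ^ n) z ∈ I := by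
    intro n
    induction n with
    | zero => exact hz
    | succ n ih => rw [pow_succ', Equiv.Perm.mul_apply]; exact hS' _ ih
  rintro _ ⟨n, rfl⟩
  obtain ⟨n, rfl | rfl⟩ := n.eq_nat_or_neg
  · obtain ⟨-, N, -, hN⟩ := exists_pow_apply_eq_of_induced hS hz n
    rw [zpow_natCast, hN]
    exact pow_mem_orbitZ N z
  · obtain ⟨-, N, -, hN⟩ := exists_pow_apply_eq_of_induced hS (hback n) n
    rw [inv_pow, perm_apply_inv_self] at hN
    have hmem : z ∈ orbitZ T ((S ^ n)⁻¹ z) := ⟨N, by rw [zpow_natCast]; exact hN.symm⟩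
    rw [zpow_neg, zpow_natCast, orbitZ_eq_of_mem hmem]
    exact mem_orbitZ_self _

end Induced
/-- two-sided Rauzy induction. The transformation induced by a
regular `s`-interval exchange transformation on an admissible semi-interval
`I = [u,v)` is a regular `s`-interval exchange transformation whose separation
points are exactly `Div(I,T) ∩ I`. -/
theorem induced_on_admissible_regular (s : ℕ) (hs : 2 ≤ s) (l r : ℝ)
    (len : Fin s → ℝ) (π : Equiv.Perm (Fin s)) (T : Equiv.Perm ℝ)
    (hIET : IsIET s l r len π T) (hreg : IsRegularIET s l len T)
    (u v : ℝ) (hadm : Admissible s l r len T u v) :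
    ∃ (lam : Fin s → ℝ) (σ : Equiv.Perm (Fin s)) (S : Equiv.Perm ℝ),
      IsIET s u v lam σ S ∧ IsRegularIET s u lam S ∧
      (∀ z ∈ Set.Ico u v, S z = inducedMap T (Set.Ico u v) z) ∧
      Set.range (sepPt u lam) = divPoints s l len T u v ∩ Set.Ico u v := by
  obtain ⟨hlu, huv, hvr, hu, hv⟩ := hadm
  have hur : u ≠ r := (huv.trans_le hvr).ne
  have hper : ∀ z ∈ Ico l r, ∀ n : ℕ, 0 < n → (T ^ n) z ≠ z :=
    fun z hz n hn => hIET.pow_apply_ne hs hreg hz hn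
  have hIsub : Ico u v ⊆ Ico l r := Ico_subset_Ico hlu hvr
  have hback : ∀ z ∈ Ico l r, ∃ n : ℕ, (T⁻¹ ^ n) z ∈ Ioo u v := fun z hz => by
    obtain ⟨N, hN⟩ := hIET.exists_inv_pow_mem_Ioo hs hreg hlu huv hvr
    obtain ⟨k, -, hk⟩ := hN z hz
    exact ⟨k, hk⟩
  have hDiv : ∀ x, x ∈ divPoints s l len T u v ↔
      ∃ i p, LastVisit T u v p x ∧ LastVisit T u v p (sepPt l len i) := fun x => by
    have hn := fun i => mem_neighbours_iff (x := x) (hback _ (hIET.sepPt_mem i))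
      (hIET.exists_pow_mem_Ioo hs hreg hlu huv hvr (hIET.sepPt_mem i))
    simp only [divPoints, mem_iUnion, hn]
  have hex : ∀ i : Fin s, ∃ p, LastVisit T u v p (sepPt l len i) :=
    fun i => ⟨_, lastVisit_rhoMinusPt (hback _ (hIET.sepPt_mem i))⟩
  choose p hp using hex
  have hporb : ∀ i, orbitZ T (p i) = orbitZ T (sepPt l len i) :=
    fun i => (orbitZ_eq_of_mem (hp i).mem_orbitZ).symm
  have hne0 : ∀ i : Fin s, i ∈ Finset.univ.erase (⟨0, by omega⟩ : Fin s) ↔ (i : ℕ) ≠ 0 :=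
    fun i => by simp [Fin.ext_iff]
  classical
  set F := (Finset.univ.erase (⟨0, by omega⟩ : Fin s)).image p with hFdef
  have hcard : F.card + 1 = s := by
    rw [hFdef, Finset.card_image_of_injOn, Finset.card_erase_of_mem (Finset.mem_univ _),
      Finset.card_univ, Fintype.card_fin]
    · omega
    · intro i hi j hj hij
      by_contra hne
      have hd := hreg.2 i j ((hne0 i).1 hi) ((hne0 j).1 hj) hne
      rw [← hporb, ← hporb, hij, disjoint_self] at hd
      have hmem : p j ∈ (⊥ : Set ℝ) := hd ▸ mem_orbitZ_self (T := T) (p j)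
      exact hmem
  have hFI : ∀ x ∈ F, x ∈ Ioo u v := by
    intro x hx
    obtain ⟨i, -, rfl⟩ := Finset.mem_image.1 hx
    exact (hp i).1
  have hFsep : ∀ i z, LastVisit T u v z (sepPt l len i) → z ∈ F := by
    intro i z hz
    by_cases hi : (i : ℕ) = 0
    · obtain ⟨q, hq, hql⟩ := hIET.exists_nonzero_apply_sepPt_eq_left hs hreg
      rw [sepPt_of_val_eq_zero hi, ← hql] at hz
      have hne : z ≠ T (sepPt l len q) := by
        rw [hql]
        exact (hlu.trans_lt hz.1.1).ne'
      rw [(hz.of_apply hne).unique (hp q)]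
      exact Finset.mem_image_of_mem p ((hne0 q).2 hq)
    · rw [hz.unique (hp i)]
      exact Finset.mem_image_of_mem p ((hne0 i).2 hi)
  have hFDiv : ∀ x ∈ divPoints s l len T u v, ∀ z, LastVisit T u v z x → z ∈ F := by
    intro x hx z hz
    obtain ⟨i, y, hyx, hyi⟩ := (hDiv x).1 hx
    rw [hz.unique hyx]
    exact hFsep i y hyi
  have hnr : ∀ z x, LastVisit T u v z x → x ≠ r := by
    rintro z x ⟨hz, n, rfl, -⟩
    exact (hIET.pow_apply_mem (hIsub (Ioo_subset_Ico_self hz)) n).2.ne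
  obtain ⟨lam, hpos, hsum, hrange, hcell⟩ := hIET.exists_return_cells hlu huv hvr F hFI
    (fun z x hzx hx => by
      rcases hx with rfl | rfl | ⟨i, rfl⟩
      · exact hFDiv x (hu.resolve_right hur) z hzx
      · exact hFDiv x (hv.resolve_right (hnr z x hzx)) z hzx
      · exact hFsep i z hzx) hcard
  choose n hn c hc using hcell
  have hret : ∀ i, ∀ z ∈ Ico (sepPt u lam i) (sepPt u lam i + lam i),
      returnTime T (Ico u v) z = n i := fun i z hz =>
    returnTime_eq (hn i) ((hc i z hz).1 ▸ (hc i z hz).2.1) (hc i z hz).2.2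
  have hind : ∀ i, ∀ z ∈ Ico (sepPt u lam i) (sepPt u lam i + lam i),
      inducedMap T (Ico u v) z = z + c i := fun i z hz => by
    rw [inducedMap, hret i z hz, (hc i z hz).1]
  have hcov : ∀ z ∈ Ico u v, ∃ i, z ∈ Ico (sepPt u lam i) (sepPt u lam i + lam i) :=
    fun z hz => exists_mem_cell (by rwa [hsum, add_sub_cancel])
  have hret0 : ∀ z ∈ Ico u v, 0 < returnTime T (Ico u v) z := fun z hz => by
    obtain ⟨i, hi⟩ := hcov z hz
    rw [hret i z hi]
    exact hn i
  have hmaps : MapsTo (inducedMap T (Ico u v)) (Ico u v) (Ico u v) := fun z hz => by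
    obtain ⟨i, hi⟩ := hcov z hz
    rw [hind i z hi]
    exact (hc i z hi).2.1
  obtain ⟨σ, S, hSIET, hS⟩ := exists_isIET_of_translations huv hpos hsum hind hmaps
    (inducedMap_injOn hret0)
  have hST : ∀ z ∈ Ico u v, S z ∈ Ico u v ∧ ∃ m : ℕ, 0 < m ∧ S z = (T ^ m) z := fun z hz =>
    ⟨hSIET.apply_mem hz, _, hret0 z hz, hS z hz⟩
  have hsepF : ∀ i : Fin s, (i : ℕ) ≠ 0 →
      ∃ j : Fin s, (j : ℕ) ≠ 0 ∧ p j = sepPt u lam i := by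
    intro i hi
    rcases hrange ▸ mem_range_self (f := sepPt u lam) i with h | h
    · exact absurd h (lt_sepPt hpos hi).ne'
    · obtain ⟨j, hj, hji⟩ := Finset.mem_image.1 h
      exact ⟨j, (hne0 j).1 hj, hji⟩
  have horb : ∀ i, orbitZ S (sepPt u lam i) ⊆ orbitZ T (sepPt u lam i) := fun i =>
    orbitZ_subset_of_induced hST (fun z hz => hSIET.inv.apply_mem hz) (hSIET.sepPt_mem i)
  refine ⟨lam, σ, S, hSIET, ⟨fun i _ => orbitZ_infinite_iff.2 fun m hm heq => ?_,
    fun i j hi hj hij => ?_⟩, hS, ?_⟩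
  · obtain ⟨-, N, hN, hSN⟩ := exists_pow_apply_eq_of_induced hST (hSIET.sepPt_mem i) m
    exact hper _ (hIsub (hSIET.sepPt_mem i)) N (by omega) (hSN.symm.trans heq)
  · obtain ⟨i', hi', hpi⟩ := hsepF i hi
    obtain ⟨j', hj', hpj⟩ := hsepF j hj
    refine Disjoint.mono (horb i) (horb j) ?_
    rw [← hpi, ← hpj, hporb, hporb]
    refine hreg.2 i' j' hi' hj' ?_
    rintro rfl
    exact hij ((sepPt_strictMono hpos).injective (hpi.symm.trans hpj))
  · rw [hrange]
    ext x
    constructor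
    · rintro (rfl | hx)
      · exact ⟨hu.resolve_right hur, le_rfl, huv⟩
      · refine ⟨(hDiv x).2 ?_, Ioo_subset_Ico_self (hFI x hx)⟩
        obtain ⟨i, -, rfl⟩ := Finset.mem_image.1 hx
        exact ⟨i, p i, .self (hp i).1, hp i⟩
    · rintro ⟨hxD, hxI⟩
      rcases hxI.1.lt_or_eq with hlt | rfl
      · exact .inr (hFDiv x hxD x (.self ⟨hlt, hxI.2⟩))
      · exact .inl rfl

end
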